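/- Let E be an associative unital k-algebra and let u : H → E be convolution invertible with convolution inverse ū. Then for every n ≥ 1 the map μ_n∘u^{⊗n} : H^{⊗_c n} → E is convolution invertible, and its convolution inverse is μ_n∘ū^{⊗n}∘γ_n. -/

import Mathlib

/-!
If `u : H → E` is a convolution invertible linear map from a braided bialgebra `H` to an
algebra `E`, with convolution inverse `ū`, then for every `n ≥ 1` the map
`μ_n∘u^{⊗n} : H^{⊗_c n} → E` is convolution invertible, with convolution inverse
`μ_n∘ū^{⊗n}∘γ_n`.  (Here `pw k H n` denotes `H^{⊗(n+1)}`, so the statement below,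
quantified over all `n : ℕ`, covers exactly all tensor powers `H^{⊗n}` with `n ≥ 1`.)
-/

open scoped TensorProduct

universe u

variable (k : Type u) [Field k]

/-- A bundled `k`-vector space. -/
structure VS (k : Type u) [Field k] : Type (u + 1) where
  /-- underlying type -/
  carrier : Type u
  [acg : AddCommGroup carrier]
  [mod : Module k carrier]

attribute [instance] VS.acg VS.mod

instance : CoeSort (VS k) (Type u) := ⟨VS.carrier⟩

/-- Iterated tensor powers: `pw k M n` is `M^{⊗(n+1)}`, right-nested. -/
noncomputable def pw (M : Type u) [AddCommGroup M] [Module k M] : ℕ → VS k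
  | 0 => ⟨M⟩
  | n + 1 => ⟨M ⊗[k] ↥(pw M n)⟩

variable {M : Type u} [AddCommGroup M] [Module k M]

/-- The canonical identification `M^{⊗(n+1)} ⊗ M ≅ M^{⊗(n+2)}`. -/
noncomputable def snoc : ∀ n : ℕ, (↥(pw k M n) ⊗[k] M) ≃ₗ[k] ↥(pw k M (n + 1))
  | 0 => LinearEquiv.refl k (M ⊗[k] M)
  | n + 1 =>
      (TensorProduct.assoc k M ↥(pw k M n) M) ≪≫ₗ
        TensorProduct.congr (LinearEquiv.refl k M) (snoc n)

/-- A braided bialgebra: an algebra-and-coalgebra `H` together with a bijective braiding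
operator `c` compatible with both structures, for which `η` is a coalgebra morphism, `ε` is
an algebra morphism and `Δ∘μ = (μ⊗μ)∘(id⊗c⊗id)∘(Δ⊗Δ)`. -/
structure BraidedBialgebra (H : Type u) [Ring H] [Algebra k H] [Coalgebra k H] where
  /-- the braid -/
  c : H ⊗[k] H ≃ₗ[k] H ⊗[k] H
  /-- `(c⊗id)∘(id⊗c)∘(c⊗id) = (id⊗c)∘(c⊗id)∘(id⊗c)` -/
  yang_baxter :
    LinearMap.rTensor H c.toLinearMap
        ∘ₗ (TensorProduct.assoc k H H H).symm.toLinearMap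
        ∘ₗ LinearMap.lTensor H c.toLinearMap
        ∘ₗ (TensorProduct.assoc k H H H).toLinearMap
        ∘ₗ LinearMap.rTensor H c.toLinearMap
      = (TensorProduct.assoc k H H H).symm.toLinearMap
        ∘ₗ LinearMap.lTensor H c.toLinearMap
        ∘ₗ (TensorProduct.assoc k H H H).toLinearMap
        ∘ₗ LinearMap.rTensor H c.toLinearMap
        ∘ₗ (TensorProduct.assoc k H H H).symm.toLinearMap
        ∘ₗ LinearMap.lTensor H c.toLinearMap
        ∘ₗ (TensorProduct.assoc k H H H).toLinearMap
  /-- `c(h⊗1) = 1⊗h` -/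
  braid_one_right : ∀ h : H, c (h ⊗ₜ[k] (1 : H)) = (1 : H) ⊗ₜ[k] h
  /-- `c(1⊗h) = h⊗1` -/
  braid_one_left : ∀ h : H, c ((1 : H) ⊗ₜ[k] h) = h ⊗ₜ[k] (1 : H)
  /-- `c∘(μ⊗id) = (id⊗μ)∘(c⊗id)∘(id⊗c)` -/
  braid_mul_right :
    c.toLinearMap ∘ₗ LinearMap.rTensor H (LinearMap.mul' k H)
      = LinearMap.lTensor H (LinearMap.mul' k H)
        ∘ₗ (TensorProduct.assoc k H H H).toLinearMap
        ∘ₗ LinearMap.rTensor H c.toLinearMap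
        ∘ₗ (TensorProduct.assoc k H H H).symm.toLinearMap
        ∘ₗ LinearMap.lTensor H c.toLinearMap
        ∘ₗ (TensorProduct.assoc k H H H).toLinearMap
  /-- `c∘(id⊗μ) = (μ⊗id)∘(id⊗c)∘(c⊗id)` -/
  braid_mul_left :
    c.toLinearMap ∘ₗ LinearMap.lTensor H (LinearMap.mul' k H)
      = LinearMap.rTensor H (LinearMap.mul' k H)
        ∘ₗ (TensorProduct.assoc k H H H).symm.toLinearMap
        ∘ₗ LinearMap.lTensor H c.toLinearMap
        ∘ₗ (TensorProduct.assoc k H H H).toLinearMap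
        ∘ₗ LinearMap.rTensor H c.toLinearMap
        ∘ₗ (TensorProduct.assoc k H H H).symm.toLinearMap
  /-- `(id⊗ε)∘c = ε⊗id` -/
  braid_counit_right :
    (TensorProduct.rid k H).toLinearMap
        ∘ₗ LinearMap.lTensor H (Coalgebra.counit (R := k) (A := H))
        ∘ₗ c.toLinearMap
      = (TensorProduct.lid k H).toLinearMap
        ∘ₗ LinearMap.rTensor H (Coalgebra.counit (R := k) (A := H))
  /-- `(ε⊗id)∘c = id⊗ε` -/
  braid_counit_left :
    (TensorProduct.lid k H).toLinearMap
        ∘ₗ LinearMap.rTensor H (Coalgebra.counit (R := k) (A := H))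
        ∘ₗ c.toLinearMap
      = (TensorProduct.rid k H).toLinearMap
        ∘ₗ LinearMap.lTensor H (Coalgebra.counit (R := k) (A := H))
  /-- `(id⊗Δ)∘c = (c⊗id)∘(id⊗c)∘(Δ⊗id)` -/
  braid_comul_right :
    LinearMap.lTensor H (Coalgebra.comul (R := k) (A := H)) ∘ₗ c.toLinearMap
      = (TensorProduct.assoc k H H H).toLinearMap
        ∘ₗ LinearMap.rTensor H c.toLinearMap
        ∘ₗ (TensorProduct.assoc k H H H).symm.toLinearMap
        ∘ₗ LinearMap.lTensor H c.toLinearMap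
        ∘ₗ (TensorProduct.assoc k H H H).toLinearMap
        ∘ₗ LinearMap.rTensor H (Coalgebra.comul (R := k) (A := H))
  /-- `(Δ⊗id)∘c = (id⊗c)∘(c⊗id)∘(id⊗Δ)` -/
  braid_comul_left :
    (TensorProduct.assoc k H H H).toLinearMap
        ∘ₗ LinearMap.rTensor H (Coalgebra.comul (R := k) (A := H))
        ∘ₗ c.toLinearMap
      = LinearMap.lTensor H c.toLinearMap
        ∘ₗ (TensorProduct.assoc k H H H).toLinearMap
        ∘ₗ LinearMap.rTensor H c.toLinearMap
        ∘ₗ (TensorProduct.assoc k H H H).symm.toLinearMap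
        ∘ₗ LinearMap.lTensor H (Coalgebra.comul (R := k) (A := H))
  /-- `Δ(1) = 1⊗1` -/
  comul_one : Coalgebra.comul (R := k) (1 : H) = (1 : H) ⊗ₜ[k] (1 : H)
  /-- `ε(1) = 1` -/
  counit_one : Coalgebra.counit (R := k) (1 : H) = (1 : k)
  /-- `ε(hl) = ε(h)ε(l)` -/
  counit_mul : ∀ h l : H,
    Coalgebra.counit (R := k) (h * l)
      = Coalgebra.counit (R := k) h * Coalgebra.counit (R := k) l
  /-- `Δ∘μ = (μ⊗μ)∘(id⊗c⊗id)∘(Δ⊗Δ)` -/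
  comul_mul :
    (Coalgebra.comul (R := k) (A := H)) ∘ₗ LinearMap.mul' k H
      = TensorProduct.map (LinearMap.mul' k H) (LinearMap.mul' k H)
        ∘ₗ (TensorProduct.assoc k H H (H ⊗[k] H)).symm.toLinearMap
        ∘ₗ LinearMap.lTensor H (TensorProduct.assoc k H H H).toLinearMap
        ∘ₗ LinearMap.lTensor H (LinearMap.rTensor H c.toLinearMap)
        ∘ₗ LinearMap.lTensor H (TensorProduct.assoc k H H H).symm.toLinearMap
        ∘ₗ (TensorProduct.assoc k H H (H ⊗[k] H)).toLinearMap
        ∘ₗ TensorProduct.map (Coalgebra.comul (R := k) (A := H))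
            (Coalgebra.comul (R := k) (A := H))


section ComulPow

variable {Hh : Type u} [AddCommGroup Hh] [Module k Hh]
variable {k}

/-- `Δ^{⊗(n+1)} : Hh^{⊗(n+1)} → (Hh⊗Hh)^{⊗(n+1)}`. -/
noncomputable def dPow (Δ : Hh →ₗ[k] Hh ⊗[k] Hh) :
    ∀ n : ℕ, ↥(pw k Hh n) →ₗ[k] ↥(pw k (Hh ⊗[k] Hh) n)
  | 0 => Δ
  | n + 1 => TensorProduct.map Δ (dPow Δ n)

/-- `id_{Hh} ⊗ c^{×(n+1)} ⊗ id_{Hh}` : the simultaneous application of `c` to the `n+1`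
consecutive interior pairs of tensor factors of `(Hh⊗Hh)^{⊗(n+2)}`. -/
noncomputable def mids (c : Hh ⊗[k] Hh →ₗ[k] Hh ⊗[k] Hh) :
    ∀ n : ℕ, ↥(pw k (Hh ⊗[k] Hh) (n + 1)) →ₗ[k] (Hh ⊗[k] (↥(pw k (Hh ⊗[k] Hh) n) ⊗[k] Hh))
  | 0 =>
      LinearMap.lTensor Hh (LinearMap.rTensor Hh c)
        ∘ₗ LinearMap.lTensor Hh (TensorProduct.assoc k Hh Hh Hh).symm.toLinearMap
        ∘ₗ (TensorProduct.assoc k Hh Hh (Hh ⊗[k] Hh)).toLinearMap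
  | n + 1 =>
      LinearMap.lTensor Hh
          (TensorProduct.assoc k (Hh ⊗[k] Hh) ↥(pw k (Hh ⊗[k] Hh) n) Hh).symm.toLinearMap
        ∘ₗ LinearMap.lTensor Hh (LinearMap.rTensor (↥(pw k (Hh ⊗[k] Hh) n) ⊗[k] Hh) c)
        ∘ₗ LinearMap.lTensor Hh
            (TensorProduct.assoc k Hh Hh (↥(pw k (Hh ⊗[k] Hh) n) ⊗[k] Hh)).symm.toLinearMap
        ∘ₗ (TensorProduct.assoc k Hh Hh
            (Hh ⊗[k] (↥(pw k (Hh ⊗[k] Hh) n) ⊗[k] Hh))).toLinearMap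
        ∘ₗ LinearMap.lTensor (Hh ⊗[k] Hh) (mids c n)

/-- `𝔠_{n+1}` (composed with the regrouping `Hh^{⊗2(n+1)} ≅ Hh^{⊗(n+1)}⊗Hh^{⊗(n+1)}`) :
defined by `𝔠_1 = id` and `𝔠_{n+1} = (id⊗𝔠_n⊗id)∘(id⊗c^{×n}⊗id)`. -/
noncomputable def cShuffle (c : Hh ⊗[k] Hh →ₗ[k] Hh ⊗[k] Hh) :
    ∀ n : ℕ, ↥(pw k (Hh ⊗[k] Hh) n) →ₗ[k] (↥(pw k Hh n) ⊗[k] ↥(pw k Hh n))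
  | 0 => LinearMap.id
  | n + 1 =>
      (TensorProduct.assoc k Hh ↥(pw k Hh n) ↥(pw k Hh (n + 1))).symm.toLinearMap
        ∘ₗ LinearMap.lTensor Hh (LinearMap.lTensor ↥(pw k Hh n) (snoc k n).toLinearMap)
        ∘ₗ LinearMap.lTensor Hh (TensorProduct.assoc k ↥(pw k Hh n) ↥(pw k Hh n) Hh).toLinearMap
        ∘ₗ LinearMap.lTensor Hh (LinearMap.rTensor Hh (cShuffle c n))
        ∘ₗ mids c n

/-- The comultiplication `Δ_{H^{⊗_c(n+1)}} := 𝔠_{n+1}∘Δ^{⊗(n+1)}` of the braided tensor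
power coalgebra. -/
noncomputable def comulP (c : Hh ⊗[k] Hh →ₗ[k] Hh ⊗[k] Hh) (Δ : Hh →ₗ[k] Hh ⊗[k] Hh)
    (n : ℕ) : ↥(pw k Hh n) →ₗ[k] (↥(pw k Hh n) ⊗[k] ↥(pw k Hh n)) :=
  cShuffle c n ∘ₗ dPow Δ n

/-- The counit `ε^{⊗(n+1)}` of the braided tensor power coalgebra. -/
noncomputable def counitP (ε : Hh →ₗ[k] k) : ∀ n : ℕ, ↥(pw k Hh n) →ₗ[k] k
  | 0 => ε
  | n + 1 => (TensorProduct.lid k k).toLinearMap ∘ₗ TensorProduct.map ε (counitP ε n)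

/-- `t_{n+2}` : carrying the first tensor factor of `Hh^{⊗(n+2)}` past the remaining `n+1`
factors by successive applications of `c` to adjacent pairs. -/
noncomputable def pushEnd (c : Hh ⊗[k] Hh →ₗ[k] Hh ⊗[k] Hh) :
    ∀ n : ℕ, (Hh ⊗[k] ↥(pw k Hh n)) →ₗ[k] (↥(pw k Hh n) ⊗[k] Hh)
  | 0 => c
  | n + 1 =>
      (TensorProduct.assoc k Hh ↥(pw k Hh n) Hh).symm.toLinearMap
        ∘ₗ LinearMap.lTensor Hh (pushEnd c n)
        ∘ₗ (TensorProduct.assoc k Hh Hh ↥(pw k Hh n)).toLinearMap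
        ∘ₗ LinearMap.rTensor ↥(pw k Hh n) c
        ∘ₗ (TensorProduct.assoc k Hh Hh ↥(pw k Hh n)).symm.toLinearMap

/-- `γ_{n+1}` : the braided order-reversal, `γ_1 = id`, `γ_2 = c`,
`γ_{n+1} = (γ_n⊗id)∘t_{n+1}`. -/
noncomputable def grev (c : Hh ⊗[k] Hh →ₗ[k] Hh ⊗[k] Hh) :
    ∀ n : ℕ, ↥(pw k Hh n) →ₗ[k] ↥(pw k Hh n)
  | 0 => LinearMap.id
  | n + 1 =>
      (snoc k n).toLinearMap ∘ₗ LinearMap.rTensor Hh (grev c n) ∘ₗ pushEnd c n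

/-- `μ_{n+1}∘u^{⊗(n+1)}` for a linear map `u : Hh → E` into an algebra `E`. -/
noncomputable def prodPow {E : Type u} [Ring E] [Algebra k E] (u : Hh →ₗ[k] E) :
    ∀ n : ℕ, ↥(pw k Hh n) →ₗ[k] E
  | 0 => u
  | n + 1 =>
      LinearMap.mul' k E
        ∘ₗ TensorProduct.map (prodPow u n) u
        ∘ₗ (snoc k n).symm.toLinearMap

end ComulPow


namespace BraidedPower
open CategoryTheory MonoidalCategory

variable {V : Type*} [Category V] [MonoidalCategory V] {H P Q E : V}

/-- Carry `H` past `H ⊗ P`, using `c` and then `τ`. -/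
abbrev braidSucc (c : H ⊗ H ⟶ H ⊗ H) (τ : H ⊗ P ⟶ P ⊗ H) : H ⊗ (H ⊗ P) ⟶ (H ⊗ P) ⊗ H :=
  (α_ H H P).inv ≫ c ▷ P ≫ (α_ H H P).hom ≫ H ◁ τ ≫ (α_ H P H).inv

/-- The comultiplication of the twisted tensor product of `(H, δ)` and `(P, Δ)` along `τ`. -/
abbrev comulSucc (τ : H ⊗ P ⟶ P ⊗ H) (δ : H ⟶ H ⊗ H) (Δ : P ⟶ P ⊗ P) :
    H ⊗ P ⟶ (H ⊗ P) ⊗ (H ⊗ P) :=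
  δ ▷ P ≫ (H ⊗ H) ◁ Δ ≫ (α_ H H (P ⊗ P)).hom ≫
    H ◁ ((α_ H P P).inv ≫ τ ▷ P ≫ (α_ P H P).hom) ≫ (α_ H P (H ⊗ P)).inv

/-- The braid relation for three strands `H`, `H`, `P`. -/
def YangBaxter (c : H ⊗ H ⟶ H ⊗ H) (τ : H ⊗ P ⟶ P ⊗ H) : Prop :=
  c ▷ P ≫ (α_ H H P).hom ≫ H ◁ τ ≫ (α_ H P H).inv ≫ τ ▷ H =
    (α_ H H P).hom ≫ H ◁ τ ≫ (α_ H P H).inv ≫ τ ▷ H ≫ (α_ P H H).hom ≫ P ◁ c ≫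
      (α_ P H H).inv

/-- Compatibility of `τ` with a comultiplication on the strand moving right. -/
def ComulRight (τ : H ⊗ P ⟶ P ⊗ H) (δ : H ⟶ H ⊗ H) : Prop :=
  τ ≫ P ◁ δ = δ ▷ P ≫ (α_ H H P).hom ≫ H ◁ τ ≫ (α_ H P H).inv ≫ τ ▷ H ≫ (α_ P H H).hom

/-- Compatibility of `τ` with a comultiplication on the strand moving left. -/
def ComulLeft (τ : H ⊗ P ⟶ P ⊗ H) (Δ : P ⟶ P ⊗ P) : Prop :=
  τ ≫ Δ ▷ H ≫ (α_ P P H).hom =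
    H ◁ Δ ≫ (α_ H P P).inv ≫ τ ▷ P ≫ (α_ P H P).hom ≫ P ◁ τ

theorem YangBaxter.succ {c : H ⊗ H ⟶ H ⊗ H} {τ : H ⊗ P ⟶ P ⊗ H}
    (hc : YangBaxter c c) (hτ : YangBaxter c τ) : YangBaxter c (braidSucc c τ) := by
  unfold YangBaxter at *
  calc
    _ = 𝟙 _ ⊗≫ (c ▷ H ≫ (α_ H H H).hom ≫ H ◁ c ≫ (α_ H H H).inv) ▷ P ⊗≫
        ((H ⊗ H) ◁ τ ≫ c ▷ (P ⊗ H)) ⊗≫ H ◁ τ ▷ H ⊗≫ 𝟙 _ := by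
      monoidal
    _ = 𝟙 _ ⊗≫ (c ▷ H ≫ (α_ H H H).hom ≫ H ◁ c ≫ (α_ H H H).inv ≫ c ▷ H) ▷ P ⊗≫
        H ◁ (H ◁ τ ≫ (α_ H P H).inv ≫ τ ▷ H) ⊗≫ 𝟙 _ := by
      rw [whisker_exchange]; monoidal
    _ = 𝟙 _ ⊗≫ H ◁ c ▷ P ⊗≫ c ▷ H ▷ P ⊗≫
        H ◁ (c ▷ P ≫ (α_ H H P).hom ≫ H ◁ τ ≫ (α_ H P H).inv ≫ τ ▷ H) ⊗≫ 𝟙 _ := by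
      rw [hc]; monoidal
    _ = 𝟙 _ ⊗≫ H ◁ c ▷ P ⊗≫ (c ▷ (H ⊗ P) ≫ (H ⊗ H) ◁ τ) ⊗≫
        H ◁ (τ ▷ H ≫ (α_ P H H).hom ≫ P ◁ c ≫ (α_ P H H).inv) ⊗≫ 𝟙 _ := by
      rw [hτ]; monoidal
    _ = _ := by
      rw [← whisker_exchange]; monoidal

theorem ComulRight.succ {c : H ⊗ H ⟶ H ⊗ H} {τ : H ⊗ P ⟶ P ⊗ H} {δ : H ⟶ H ⊗ H}
    (hc : ComulRight c δ) (hτ : ComulRight τ δ) : ComulRight (braidSucc c τ) δ := by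
  unfold ComulRight at *
  calc
    _ = (α_ H H P).inv ≫ c ▷ P ⊗≫ H ◁ (τ ≫ P ◁ δ) ⊗≫ 𝟙 _ := by monoidal
    _ = (α_ H H P).inv ≫ (c ≫ H ◁ δ) ▷ P ⊗≫
        H ◁ (H ◁ τ ≫ (α_ H P H).inv ≫ τ ▷ H) ⊗≫ 𝟙 _ := by rw [hτ]; monoidal
    _ = 𝟙 _ ⊗≫ δ ▷ H ▷ P ⊗≫ H ◁ c ▷ P ⊗≫ (c ▷ (H ⊗ P) ≫ (H ⊗ H) ◁ τ) ⊗≫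
        H ◁ τ ▷ H ⊗≫ 𝟙 _ := by rw [hc]; monoidal
    _ = _ := by rw [← whisker_exchange]; monoidal

theorem ComulLeft.succ {c : H ⊗ H ⟶ H ⊗ H} {τ : H ⊗ P ⟶ P ⊗ H} {δ : H ⟶ H ⊗ H}
    {Δ : P ⟶ P ⊗ P} (hy : YangBaxter c τ)
    (hc : ComulLeft c δ) (hτ : ComulLeft τ Δ) :
    ComulLeft (braidSucc c τ) (comulSucc τ δ Δ) := by
  unfold ComulLeft YangBaxter at *
  calc
    _ = 𝟙 _ ⊗≫ c ▷ P ⊗≫ (H ◁ τ ≫ δ ▷ (P ⊗ H)) ⊗≫ (H ⊗ H) ◁ Δ ▷ H ⊗≫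
        H ◁ τ ▷ P ▷ H ⊗≫ 𝟙 _ := by monoidal
    _ = 𝟙 _ ⊗≫ (c ≫ δ ▷ H ≫ (α_ H H H).hom) ▷ P ⊗≫
        (H ⊗ H) ◁ (τ ≫ Δ ▷ H ≫ (α_ P P H).hom) ⊗≫ H ◁ τ ▷ P ▷ H ⊗≫ 𝟙 _ := by
      rw [whisker_exchange]; monoidal
    _ = 𝟙 _ ⊗≫ H ◁ δ ▷ P ⊗≫ c ▷ H ▷ P ⊗≫ H ◁ (c ▷ P ≫ (H ⊗ H) ◁ Δ) ⊗≫
        H ◁ H ◁ τ ▷ P ⊗≫ H ◁ ((H ⊗ P) ◁ τ ≫ τ ▷ (P ⊗ H)) ⊗≫ 𝟙 _ := by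
      rw [hc, hτ]; monoidal
    _ = 𝟙 _ ⊗≫ H ◁ δ ▷ P ⊗≫ (c ▷ (H ⊗ P) ≫ (H ⊗ H) ◁ H ◁ Δ) ⊗≫
        H ◁ (c ▷ P ≫ (α_ H H P).hom ≫ H ◁ τ ≫ (α_ H P H).inv ≫ τ ▷ H) ▷ P ⊗≫
        H ◁ P ◁ H ◁ τ ⊗≫ 𝟙 _ := by
      rw [← whisker_exchange c Δ, whisker_exchange τ τ]; monoidal
    _ = 𝟙 _ ⊗≫ H ◁ δ ▷ P ⊗≫ H ◁ (H ⊗ H) ◁ Δ ⊗≫ (c ▷ (H ⊗ (P ⊗ P)) ≫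
        (H ⊗ H) ◁ ((α_ H P P).inv ≫ τ ▷ P ≫ (α_ P H P).hom)) ⊗≫
        H ◁ τ ▷ H ▷ P ⊗≫ H ◁ P ◁ c ▷ P ⊗≫ H ◁ P ◁ H ◁ τ ⊗≫ 𝟙 _ := by
      rw [hy, ← whisker_exchange]; monoidal
    _ = _ := by
      rw [← whisker_exchange]; monoidal

/-- Given `m` moving `H` past `Q`, interleave `H` with `(H ⊗ H) ⊗ Q`, braiding once. -/
abbrev midsSucc (c : H ⊗ H ⟶ H ⊗ H) (m : H ⊗ Q ⟶ Q ⊗ H) :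
    H ⊗ ((H ⊗ H) ⊗ Q) ⟶ ((H ⊗ H) ⊗ Q) ⊗ H :=
  H ◁ (α_ H H Q).hom ≫ H ◁ H ◁ m ≫ (α_ H H (Q ⊗ H)).inv ≫ c ▷ (Q ⊗ H) ≫
    (α_ (H ⊗ H) Q H).inv

theorem shuffle_succ {c : H ⊗ H ⟶ H ⊗ H} {τ : H ⊗ P ⟶ P ⊗ H} {m : H ⊗ Q ⟶ Q ⊗ H}
    {S : Q ⟶ P ⊗ P} {s : P ⊗ H ⟶ H ⊗ P} {S' : (H ⊗ H) ⊗ Q ⟶ (H ⊗ P) ⊗ (H ⊗ P)}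
    (h : m ≫ S ▷ H ≫ (α_ P P H).hom ≫ P ◁ s =
      H ◁ S ≫ (α_ H P P).inv ≫ τ ▷ P ≫ (α_ P H P).hom)
    (hS : S' = (α_ H H Q).hom ≫ H ◁ (m ≫ S ▷ H ≫ (α_ P P H).hom ≫ P ◁ s) ≫
      (α_ H P (H ⊗ P)).inv) :
    midsSucc c m ≫ S' ▷ H ≫ (α_ (H ⊗ P) (H ⊗ P) H).hom ≫
        (H ⊗ P) ◁ ((α_ H P H).hom ≫ H ◁ s) =
      H ◁ S' ≫ (α_ H (H ⊗ P) (H ⊗ P)).inv ≫ braidSucc c τ ▷ (H ⊗ P) ≫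
        (α_ (H ⊗ P) H (H ⊗ P)).hom := by
  rw [hS, h]
  calc
    _ = 𝟙 _ ⊗≫ H ◁ H ◁ m ⊗≫ (c ▷ (Q ⊗ H) ≫ (H ⊗ H) ◁ S ▷ H) ⊗≫
        H ◁ (τ ▷ (P ⊗ H) ≫ (P ⊗ H) ◁ s) ⊗≫ 𝟙 _ := by monoidal
    _ = 𝟙 _ ⊗≫ H ◁ H ◁ m ⊗≫ H ◁ H ◁ S ▷ H ⊗≫ (c ▷ (P ⊗ (P ⊗ H)) ≫ (H ⊗ H) ◁ P ◁ s) ⊗≫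
        H ◁ (τ ▷ (H ⊗ P)) ⊗≫ 𝟙 _ := by rw [← whisker_exchange, ← whisker_exchange]; monoidal
    _ = 𝟙 _ ⊗≫ H ◁ H ◁ (m ≫ S ▷ H ≫ (α_ P P H).hom ≫ P ◁ s) ⊗≫ c ▷ (P ⊗ (H ⊗ P)) ⊗≫
        H ◁ (τ ▷ (H ⊗ P)) ⊗≫ 𝟙 _ := by rw [← whisker_exchange]; monoidal
    _ = _ := by rw [h]; monoidal

theorem mids_succ_factor {c : H ⊗ H ⟶ H ⊗ H} {m : H ⊗ Q ⟶ Q ⊗ H}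
    {M : (H ⊗ H) ⊗ Q ⟶ H ⊗ (Q ⊗ H)} (h : M = (α_ H H Q).hom ≫ H ◁ m) :
    (H ⊗ H) ◁ M ≫ (α_ H H (H ⊗ (Q ⊗ H))).hom ≫ H ◁ (α_ H H (Q ⊗ H)).inv ≫
        H ◁ c ▷ (Q ⊗ H) ≫ H ◁ (α_ (H ⊗ H) Q H).inv =
      (α_ H H ((H ⊗ H) ⊗ Q)).hom ≫ H ◁ midsSucc c m := by
  rw [h]; monoidal

theorem shuffle_succ_factor {m : H ⊗ Q ⟶ Q ⊗ H} {M : (H ⊗ H) ⊗ Q ⟶ H ⊗ (Q ⊗ H)}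
    {S : Q ⟶ P ⊗ P} {s : P ⊗ H ⟶ H ⊗ P} (h : M = (α_ H H Q).hom ≫ H ◁ m) :
    M ≫ H ◁ S ▷ H ≫ H ◁ (α_ P P H).hom ≫ H ◁ P ◁ s ≫ (α_ H P (H ⊗ P)).inv =
      (α_ H H Q).hom ≫ H ◁ (m ≫ S ▷ H ≫ (α_ P P H).hom ≫ P ◁ s) ≫ (α_ H P (H ⊗ P)).inv := by
  simp [h]

theorem comulSucc_eq {τ : H ⊗ P ⟶ P ⊗ H} {δ : H ⟶ H ⊗ H} {m : H ⊗ Q ⟶ Q ⊗ H}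
    {S : Q ⟶ P ⊗ P} {s : P ⊗ H ⟶ H ⊗ P} {D : P ⟶ Q}
    (h : m ≫ S ▷ H ≫ (α_ P P H).hom ≫ P ◁ s =
      H ◁ S ≫ (α_ H P P).inv ≫ τ ▷ P ≫ (α_ P H P).hom) :
    (δ ⊗ₘ D) ≫ (α_ H H Q).hom ≫ H ◁ (m ≫ S ▷ H ≫ (α_ P P H).hom ≫ P ◁ s) ≫
      (α_ H P (H ⊗ P)).inv = comulSucc τ δ (D ≫ S) := by
  rw [h, MonoidalCategory.tensorHom_def]; monoidal

theorem counitRight_succ {c : H ⊗ H ⟶ H ⊗ H} {τ : H ⊗ P ⟶ P ⊗ H} {e : H ⟶ 𝟙_ V}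
    (hc : c ≫ H ◁ e ≫ (ρ_ H).hom = e ▷ H ≫ (λ_ H).hom)
    (hτ : τ ≫ P ◁ e ≫ (ρ_ P).hom = e ▷ P ≫ (λ_ P).hom) :
    braidSucc c τ ≫ (H ⊗ P) ◁ e ≫ (ρ_ (H ⊗ P)).hom = e ▷ (H ⊗ P) ≫ (λ_ (H ⊗ P)).hom := by
  calc
    _ = 𝟙 _ ⊗≫ c ▷ P ⊗≫ H ◁ (τ ≫ P ◁ e ≫ (ρ_ P).hom) ⊗≫ 𝟙 _ := by monoidal
    _ = 𝟙 _ ⊗≫ (c ≫ H ◁ e ≫ (ρ_ H).hom) ▷ P ⊗≫ 𝟙 _ := by rw [hτ]; monoidal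
    _ = _ := by rw [hc]; monoidal

theorem counitLeft_succ {c : H ⊗ H ⟶ H ⊗ H} {τ : H ⊗ P ⟶ P ⊗ H} {e : H ⟶ 𝟙_ V}
    {e' : P ⟶ 𝟙_ V}
    (hc : c ≫ e ▷ H ≫ (λ_ H).hom = H ◁ e ≫ (ρ_ H).hom)
    (hτ : τ ≫ e' ▷ H ≫ (λ_ H).hom = H ◁ e' ≫ (ρ_ H).hom) :
    braidSucc c τ ≫ ((e ⊗ₘ e') ≫ (λ_ (𝟙_ V)).hom) ▷ H ≫ (λ_ H).hom =
      H ◁ ((e ⊗ₘ e') ≫ (λ_ (𝟙_ V)).hom) ≫ (ρ_ H).hom := by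
  rw [tensorHom_def']
  calc
    _ = 𝟙 _ ⊗≫ c ▷ P ⊗≫ H ◁ (τ ≫ e' ▷ H ≫ (λ_ H).hom) ⊗≫ e ▷ H ⊗≫ 𝟙 _ := by monoidal
    _ = 𝟙 _ ⊗≫ (c ▷ P ≫ (H ⊗ H) ◁ e') ⊗≫ e ▷ H ⊗≫ 𝟙 _ := by rw [hτ]; monoidal
    _ = 𝟙 _ ⊗≫ H ◁ H ◁ e' ⊗≫ (c ≫ e ▷ H ≫ (λ_ H).hom) ⊗≫ 𝟙 _ := by
      rw [← whisker_exchange]; monoidal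
    _ = _ := by rw [hc]; monoidal

theorem tensor_mul_tensor_mul {A B C D : V} {μ : E ⊗ E ⟶ E}
    (hμ : μ ▷ E ≫ μ = (α_ E E E).hom ≫ E ◁ μ ≫ μ)
    (f : A ⟶ E) (g : B ⟶ E) (g' : C ⟶ E) (f' : D ⟶ E) :
    ((f ⊗ₘ g) ≫ μ ⊗ₘ (g' ⊗ₘ f') ≫ μ) ≫ μ =
      (α_ A B (C ⊗ D)).hom ≫ A ◁ ((α_ B C D).inv ≫ ((g ⊗ₘ g') ≫ μ) ▷ D ≫ E ◁ f' ≫ μ) ≫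
        f ▷ E ≫ μ := by
  have h4 : (μ ⊗ₘ μ) ≫ μ =
      (α_ E E (E ⊗ E)).hom ≫ E ◁ ((α_ E E E).inv ≫ μ ▷ E ≫ μ) ≫ μ := by
    rw [tensorHom_def', Category.assoc, hμ]
    simp
  calc
    _ = ((f ⊗ₘ g) ⊗ₘ (g' ⊗ₘ f')) ≫ (μ ⊗ₘ μ) ≫ μ := by
      rw [tensorHom_comp_tensorHom_assoc]
    _ = (α_ A B (C ⊗ D)).hom ≫ (f ⊗ₘ ((g ⊗ₘ (g' ⊗ₘ f')) ≫ (α_ E E E).inv ≫ μ ▷ E ≫ μ)) ≫ μ := by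
      rw [h4, associator_naturality_assoc, ← id_tensorHom, tensorHom_comp_tensorHom_assoc,
        Category.comp_id]
    _ = _ := by
      rw [associator_inv_naturality_assoc, tensorHom_def' f, ← tensorHom_id,
        tensorHom_comp_tensorHom_assoc, Category.comp_id, tensorHom_def _ f']
      simp

theorem conv_right {τ : H ⊗ P ⟶ P ⊗ H} {δ : H ⟶ H ⊗ H} {Δ : P ⟶ P ⊗ P}
    {e : H ⟶ 𝟙_ V} {e' : P ⟶ 𝟙_ V} {μ : E ⊗ E ⟶ E} {η : 𝟙_ V ⟶ E} {f f' : H ⟶ E} {g g' : P ⟶ E}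
    (hμ : μ ▷ E ≫ μ = (α_ E E E).hom ≫ E ◁ μ ≫ μ)
    (hη : η ▷ E ≫ μ = (λ_ E).hom)
    (hΔ : ComulLeft τ Δ)
    (he : τ ≫ e' ▷ H ≫ (λ_ H).hom = H ◁ e' ≫ (ρ_ H).hom)
    (hf : δ ≫ (f ⊗ₘ f') ≫ μ = e ≫ η)
    (hg : Δ ≫ (g ⊗ₘ g') ≫ μ = e' ≫ η) :
    comulSucc τ δ Δ ≫ (((f ⊗ₘ g) ≫ μ) ⊗ₘ (τ ≫ (g' ⊗ₘ f') ≫ μ)) ≫ μ =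
      ((e ⊗ₘ e') ≫ (λ_ (𝟙_ V)).hom) ≫ η := by
  unfold ComulLeft at hΔ
  calc
    _ = 𝟙 _ ⊗≫ δ ▷ P ⊗≫ H ◁ (H ◁ Δ ≫ (α_ H P P).inv ≫ τ ▷ P ≫ (α_ P H P).hom ≫ P ◁ τ) ⊗≫
        ((f ⊗ₘ g) ≫ μ ⊗ₘ (g' ⊗ₘ f') ≫ μ) ≫ μ := by
      have : (((f ⊗ₘ g) ≫ μ) ⊗ₘ (τ ≫ (g' ⊗ₘ f') ≫ μ)) =
        (H ⊗ P) ◁ τ ≫ ((f ⊗ₘ g) ≫ μ ⊗ₘ (g' ⊗ₘ f') ≫ μ) := by simp [tensorHom_def']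
      rw [this]; monoidal
    _ = δ ▷ P ⊗≫ H ◁ (τ ≫ (Δ ≫ (g ⊗ₘ g') ≫ μ) ▷ H ≫ E ◁ f' ≫ μ) ≫
        f ▷ E ≫ μ := by
      rw [← hΔ, tensor_mul_tensor_mul hμ]; monoidal
    _ = δ ▷ P ⊗≫ H ◁ ((τ ≫ e' ▷ H ≫ (λ_ H).hom) ⊗≫ (η ▷ H ≫ E ◁ f') ≫ μ) ≫
        f ▷ E ≫ μ := by
      rw [hg]; monoidal
    _ = δ ▷ P ⊗≫ (H ⊗ H) ◁ e' ⊗≫ H ◁ f' ⊗≫ H ◁ (η ▷ E ≫ μ) ≫ f ▷ E ≫ μ := by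
      rw [he, ← whisker_exchange]; monoidal
    _ = (δ ▷ P ≫ (H ⊗ H) ◁ e') ⊗≫ (H ◁ f' ≫ f ▷ E) ≫ μ := by
      rw [hη]; monoidal
    _ = H ◁ e' ⊗≫ (δ ≫ (f ⊗ₘ f') ≫ μ) := by
      rw [← whisker_exchange, ← tensorHom_def' f f']; monoidal
    _ = _ := by
      rw [hf, tensorHom_def']; monoidal

theorem conv_left {τ : H ⊗ P ⟶ P ⊗ H} {δ : H ⟶ H ⊗ H} {Δ : P ⟶ P ⊗ P}
    {e : H ⟶ 𝟙_ V} {e' : P ⟶ 𝟙_ V} {μ : E ⊗ E ⟶ E} {η : 𝟙_ V ⟶ E} {f f' : H ⟶ E} {g g' : P ⟶ E}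
    (hμ : μ ▷ E ≫ μ = (α_ E E E).hom ≫ E ◁ μ ≫ μ)
    (hη : η ▷ E ≫ μ = (λ_ E).hom)
    (hδ : ComulRight τ δ)
    (he : τ ≫ P ◁ e ≫ (ρ_ P).hom = e ▷ P ≫ (λ_ P).hom)
    (hf : δ ≫ (f' ⊗ₘ f) ≫ μ = e ≫ η)
    (hg : Δ ≫ (g' ⊗ₘ g) ≫ μ = e' ≫ η) :
    comulSucc τ δ Δ ≫ ((τ ≫ (g' ⊗ₘ f') ≫ μ) ⊗ₘ ((f ⊗ₘ g) ≫ μ)) ≫ μ =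
      ((e ⊗ₘ e') ≫ (λ_ (𝟙_ V)).hom) ≫ η := by
  unfold ComulRight at hδ
  calc
    _ = H ◁ Δ ⊗≫ (δ ▷ P ≫ (α_ H H P).hom ≫ H ◁ τ ≫ (α_ H P H).inv ≫ τ ▷ H ≫
        (α_ P H H).hom) ▷ P ⊗≫ ((g' ⊗ₘ f') ≫ μ ⊗ₘ (f ⊗ₘ g) ≫ μ) ≫ μ := by
      have : ((τ ≫ (g' ⊗ₘ f') ≫ μ) ⊗ₘ ((f ⊗ₘ g) ≫ μ)) =
        τ ▷ (H ⊗ P) ≫ ((g' ⊗ₘ f') ≫ μ ⊗ₘ (f ⊗ₘ g) ≫ μ) := by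
        rw [← tensorHom_id, tensorHom_comp_tensorHom, Category.id_comp]
      rw [this, comulSucc, ← whisker_exchange_assoc]; monoidal
    _ = H ◁ Δ ⊗≫ τ ▷ P ⊗≫ P ◁ ((δ ≫ (f' ⊗ₘ f) ≫ μ) ▷ P ≫ E ◁ g ≫ μ) ≫ g' ▷ E ≫ μ := by
      rw [← hδ, tensor_mul_tensor_mul hμ]; monoidal
    _ = H ◁ Δ ⊗≫ τ ▷ P ⊗≫ P ◁ (e ▷ P ⊗≫ (η ▷ P ≫ E ◁ g) ≫ μ) ≫ g' ▷ E ≫ μ := by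
      rw [hf]; monoidal
    _ = H ◁ Δ ⊗≫ (τ ≫ P ◁ e ≫ (ρ_ P).hom) ▷ P ⊗≫ P ◁ g ⊗≫ P ◁ (η ▷ E ≫ μ) ≫ g' ▷ E ≫ μ := by
      rw [← whisker_exchange]; monoidal
    _ = (H ◁ Δ ≫ e ▷ (P ⊗ P)) ⊗≫ (P ◁ g ≫ g' ▷ E) ≫ μ := by
      rw [he, hη]; monoidal
    _ = e ▷ P ⊗≫ (Δ ≫ (g' ⊗ₘ g) ≫ μ) := by
      rw [whisker_exchange, ← tensorHom_def' g' g]; monoidal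
    _ = _ := by
      rw [hg, MonoidalCategory.tensorHom_def]; monoidal

end BraidedPower

section Concrete
open CategoryTheory MonoidalCategory BraidedPower

variable {k}
variable (c : M ⊗[k] M →ₗ[k] M ⊗[k] M)

namespace BraidedPower

/-- `pw k M n` as an object of the category of `k`-modules. -/
noncomputable abbrev pwObj (k M : Type u) [Field k] [AddCommGroup M] [Module k M] (n : ℕ) :
    ModuleCat.{u} k :=
  ModuleCat.of k (pw k M n)

/-- `pushEnd` as a morphism. -/
noncomputable abbrev pushHom (n : ℕ) :
    ModuleCat.of k M ⊗ pwObj k M n ⟶ pwObj k M n ⊗ ModuleCat.of k M :=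
  ModuleCat.ofHom (pushEnd c n)

/-- The braid as a morphism. -/
noncomputable abbrev braidHom :
    ModuleCat.of k M ⊗ ModuleCat.of k M ⟶ ModuleCat.of k M ⊗ ModuleCat.of k M :=
  ModuleCat.ofHom c

/-- `mids` with the inert first tensor factor removed. -/
noncomputable def midTail : ∀ n : ℕ, ModuleCat.of k M ⊗ pwObj k (M ⊗[k] M) n ⟶
    pwObj k (M ⊗[k] M) n ⊗ ModuleCat.of k M
  | 0 => (α_ (ModuleCat.of k M) (ModuleCat.of k M) (ModuleCat.of k M)).inv ≫
      braidHom c ▷ ModuleCat.of k M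
  | n + 1 => midsSucc (braidHom c) (midTail n)

/-- `mids` as a morphism. -/
noncomputable abbrev midsHom (n : ℕ) :
    (ModuleCat.of k M ⊗ ModuleCat.of k M) ⊗ pwObj k (M ⊗[k] M) n ⟶
    ModuleCat.of k M ⊗ (pwObj k (M ⊗[k] M) n ⊗ ModuleCat.of k M) :=
  ModuleCat.ofHom (mids c n)

/-- `snoc` as a morphism. -/
noncomputable abbrev snocHom (n : ℕ) :
    pwObj k M n ⊗ ModuleCat.of k M ⟶ ModuleCat.of k M ⊗ pwObj k M n :=
  ModuleCat.ofHom (snoc k n).toLinearMap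

/-- `cShuffle` as a morphism. -/
noncomputable abbrev shuffleHom (n : ℕ) :
    pwObj k (M ⊗[k] M) n ⟶ pwObj k M n ⊗ pwObj k M n :=
  ModuleCat.ofHom (cShuffle c n)

theorem midsHom_eq (n : ℕ) : midsHom c n = (α_ _ _ _).hom ≫ ModuleCat.of k M ◁ midTail c n := by
  induction n with
  | zero =>
    have h := MonoidalCategory.whiskerLeft_comp (ModuleCat.of k M)
      (α_ (ModuleCat.of k M) (ModuleCat.of k M) (ModuleCat.of k M)).inv
      (braidHom c ▷ ModuleCat.of k M)
    exact (congrArg ((α_ (ModuleCat.of k M) (ModuleCat.of k M)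
      (ModuleCat.of k M ⊗ ModuleCat.of k M)).hom ≫ ·) h).symm
  | succ n ih =>
    exact mids_succ_factor (H := ModuleCat.of k M) (Q := pwObj k (M ⊗[k] M) n)
      (c := braidHom c) (m := midTail c n) (M := midsHom c n) ih

theorem shuffleHom_succ (n : ℕ) : shuffleHom c (n + 1) = (α_ _ _ _).hom ≫ ModuleCat.of k M ◁
      (midTail c n ≫ shuffleHom c n ▷ ModuleCat.of k M ≫ (α_ _ _ _).hom ≫
        pwObj k M n ◁ snocHom n) ≫ (α_ _ _ (ModuleCat.of k M ⊗ pwObj k M n)).inv := by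
  have : shuffleHom c (n + 1) = midsHom c n ≫
      ModuleCat.of k M ◁ shuffleHom c n ▷ ModuleCat.of k M ≫
      ModuleCat.of k M ◁ (α_ (pwObj k M n) (pwObj k M n) (ModuleCat.of k M)).hom ≫
      ModuleCat.of k M ◁ pwObj k M n ◁ snocHom n ≫
      (α_ (ModuleCat.of k M) (pwObj k M n) (ModuleCat.of k M ⊗ pwObj k M n)).inv := rfl
  exact this.trans (shuffle_succ_factor (midsHom_eq c n))

theorem midTail_shuffleHom (n : ℕ) :
    midTail c n ≫ shuffleHom c n ▷ ModuleCat.of k M ≫ (α_ _ _ _).hom ≫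
        pwObj k M n ◁ snocHom n =
      ModuleCat.of k M ◁ shuffleHom c n ≫ (α_ _ _ _).inv ≫ pushHom c n ▷ pwObj k M n ≫
        (α_ _ _ _).hom := by
  induction n with
  | zero =>
    change _ ≫ 𝟙 _ ▷ _ ≫ _ ≫ _ ◁ 𝟙 _ = _ ◁ 𝟙 _ ≫ _
    rw [id_whiskerRight, MonoidalCategory.whiskerLeft_id, MonoidalCategory.whiskerLeft_id]
    rfl
  | succ n ih =>
    have h := shuffle_succ (H := ModuleCat.of k M) (P := pwObj k M n)
      (Q := pwObj k (M ⊗[k] M) n) (c := braidHom c) (τ := pushHom c n) (m := midTail c n)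
      (S := shuffleHom c n) (s := snocHom n) ih rfl
    rw [← shuffleHom_succ] at h
    exact h

theorem comulP_succ (Δ : M →ₗ[k] M ⊗[k] M) (n : ℕ) :
    ModuleCat.ofHom (comulP c Δ (n + 1)) = comulSucc (H := ModuleCat.of k M) (P := pwObj k M n)
      (pushHom c n) (ModuleCat.ofHom Δ) (ModuleCat.ofHom (comulP c Δ n)) := by
  have h := comulSucc_eq (H := ModuleCat.of k M) (P := pwObj k M n)
    (Q := pwObj k (M ⊗[k] M) n) (δ := ModuleCat.ofHom Δ)
    (D := ModuleCat.ofHom (dPow Δ n)) (midTail_shuffleHom c n)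
  rw [← shuffleHom_succ] at h
  exact h

theorem yangBaxter_pushHom (hc : YangBaxter (braidHom c) (braidHom c)) (n : ℕ) :
    YangBaxter (braidHom c) (pushHom c n) := by
  induction n with
  | zero => exact hc
  | succ n ih =>
    exact YangBaxter.succ (H := ModuleCat.of k M) (P := pwObj k M n) (c := braidHom c)
      (τ := pushHom c n) hc ih

theorem comulRight_pushHom {Δ : M →ₗ[k] M ⊗[k] M}
    (hc : ComulRight (braidHom c) (ModuleCat.ofHom Δ)) (n : ℕ) :
    ComulRight (pushHom c n) (ModuleCat.ofHom Δ) := by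
  induction n with
  | zero => exact hc
  | succ n ih =>
    exact ComulRight.succ (H := ModuleCat.of k M) (P := pwObj k M n) (c := braidHom c)
      (τ := pushHom c n) hc ih

theorem comulLeft_pushHom {Δ : M →ₗ[k] M ⊗[k] M}
    (hy : YangBaxter (braidHom c) (braidHom c))
    (hc : ComulLeft (braidHom c) (ModuleCat.ofHom Δ)) (n : ℕ) :
    ComulLeft (pushHom c n) (ModuleCat.ofHom (comulP c Δ n)) := by
  induction n with
  | zero => exact hc
  | succ n ih =>
    rw [comulP_succ]
    exact ComulLeft.succ (H := ModuleCat.of k M) (P := pwObj k M n) (c := braidHom c)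
      (τ := pushHom c n) (yangBaxter_pushHom c hy n) hc ih

/-- The counit as a morphism. -/
noncomputable abbrev counitHom (ε : M →ₗ[k] k) : ModuleCat.of k M ⟶ 𝟙_ (ModuleCat.{u} k) :=
  ModuleCat.ofHom ε

/-- `counitP` as a morphism. -/
noncomputable abbrev counitPHom (ε : M →ₗ[k] k) (n : ℕ) : pwObj k M n ⟶ 𝟙_ (ModuleCat.{u} k) :=
  ModuleCat.ofHom (counitP ε n)

theorem pushHom_counit_right {ε : M →ₗ[k] k}
    (hc : braidHom c ≫ ModuleCat.of k M ◁ counitHom ε ≫ (ρ_ _).hom =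
      counitHom ε ▷ ModuleCat.of k M ≫ (λ_ _).hom) (n : ℕ) :
    pushHom c n ≫ pwObj k M n ◁ counitHom ε ≫ (ρ_ _).hom =
      counitHom ε ▷ pwObj k M n ≫ (λ_ _).hom := by
  induction n with
  | zero => exact hc
  | succ n ih =>
    exact counitRight_succ (H := ModuleCat.of k M) (P := pwObj k M n) (c := braidHom c)
      (τ := pushHom c n) hc ih

theorem pushHom_counit_left {ε : M →ₗ[k] k}
    (hc : braidHom c ≫ counitHom ε ▷ ModuleCat.of k M ≫ (λ_ _).hom =
      ModuleCat.of k M ◁ counitHom ε ≫ (ρ_ _).hom) (n : ℕ) :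
    pushHom c n ≫ counitPHom ε n ▷ ModuleCat.of k M ≫ (λ_ _).hom =
      ModuleCat.of k M ◁ counitPHom ε n ≫ (ρ_ _).hom := by
  induction n with
  | zero => exact hc
  | succ n ih =>
    exact counitLeft_succ (H := ModuleCat.of k M) (P := pwObj k M n) (c := braidHom c)
      (τ := pushHom c n) hc ih

end BraidedPower

variable {E : Type u} [Ring E] [Algebra k E]

theorem prodPow_succ_snoc (u : M →ₗ[k] E) (n : ℕ) (z : pw k M n ⊗[k] M) :
    prodPow u (n + 1) (snoc k n z) =
      LinearMap.mul' k E (TensorProduct.map (prodPow u n) u z) := by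
  change LinearMap.mul' k E (TensorProduct.map (prodPow u n) u
    ((snoc k n).symm (snoc k n z))) = _
  rw [LinearEquiv.symm_apply_apply]

theorem prodPow_succ (u : M →ₗ[k] E) (n : ℕ) :
    prodPow u (n + 1) = LinearMap.mul' k E ∘ₗ TensorProduct.map u (prodPow u n) := by
  induction n with
  | zero => rfl
  | succ n ih =>
    have h : (LinearMap.mul' k E ∘ₗ TensorProduct.map u (prodPow u (n + 1))) ∘ₗ
        TensorProduct.map LinearMap.id (snoc k n).toLinearMap ∘ₗ
        (TensorProduct.assoc k M (pw k M n) M).toLinearMap =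
        LinearMap.mul' k E ∘ₗ TensorProduct.map
          (LinearMap.mul' k E ∘ₗ TensorProduct.map u (prodPow u n)) u := by
      refine TensorProduct.ext_threefold fun x p y ↦ ?_
      change u x * prodPow u (n + 1) (snoc k n (p ⊗ₜ y)) = (u x * prodPow u n p) * u y
      rw [prodPow_succ_snoc, mul_assoc]
      rfl
    rw [← ih] at h
    refine LinearMap.ext fun x ↦ ?_
    obtain ⟨z, rfl⟩ := (snoc k (n + 1)).surjective x
    exact (prodPow_succ_snoc u (n + 1) z).trans (LinearMap.congr_fun h z).symm

theorem prodPow_comp_grev_succ (u : M →ₗ[k] E) (n : ℕ) :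
    prodPow u (n + 1) ∘ₗ grev c (n + 1) = LinearMap.mul' k E ∘ₗ
      TensorProduct.map (prodPow u n ∘ₗ grev c n) u ∘ₗ pushEnd c n := by
  refine LinearMap.ext fun x ↦ ?_
  have h : TensorProduct.map (prodPow u n ∘ₗ grev c n) u =
      TensorProduct.map (prodPow u n) u ∘ₗ LinearMap.rTensor M (grev c n) := by
    rw [LinearMap.map_comp_rTensor]
  rw [h]
  exact prodPow_succ_snoc u n (LinearMap.rTensor M (grev c n) (pushEnd c n x))

theorem ofHom_mul'_assoc (k E : Type u) [Field k] [Ring E] [Algebra k E] :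
    ModuleCat.ofHom (LinearMap.mul' k E) ▷ ModuleCat.of k E ≫
        ModuleCat.ofHom (LinearMap.mul' k E) =
      (α_ (ModuleCat.of k E) (ModuleCat.of k E) (ModuleCat.of k E)).hom ≫
        ModuleCat.of k E ◁ ModuleCat.ofHom (LinearMap.mul' k E) ≫
        ModuleCat.ofHom (LinearMap.mul' k E) :=
  ModuleCat.hom_ext (TensorProduct.ext_threefold fun x y z ↦ mul_assoc x y z)

theorem ofHom_linearMap_mul' (k E : Type u) [Field k] [Ring E] [Algebra k E] :
    (ModuleCat.ofHom (Algebra.linearMap k E) : 𝟙_ (ModuleCat.{u} k) ⟶ ModuleCat.of k E) ▷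
        ModuleCat.of k E ≫ ModuleCat.ofHom (LinearMap.mul' k E) = (λ_ (ModuleCat.of k E)).hom :=
  ModuleCat.hom_ext (TensorProduct.ext' fun x y ↦ (Algebra.smul_def x y).symm)

variable {H : Type u} [Ring H] [Algebra k H] [Coalgebra k H] (bb : BraidedBialgebra k H)
  {u ub : H →ₗ[k] E}

theorem prodPow_conv_prodPow_grev
    (hu : LinearMap.mul' k E ∘ₗ TensorProduct.map u ub ∘ₗ Coalgebra.comul =
      Algebra.linearMap k E ∘ₗ Coalgebra.counit) (n : ℕ) :
    LinearMap.mul' k E ∘ₗ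
        TensorProduct.map (prodPow u n) (prodPow ub n ∘ₗ grev bb.c.toLinearMap n) ∘ₗ
        comulP bb.c.toLinearMap Coalgebra.comul n =
      Algebra.linearMap k E ∘ₗ counitP Coalgebra.counit n := by
  induction n with
  | zero => exact hu
  | succ n ih =>
    rw [prodPow_comp_grev_succ, prodPow_succ]
    have h := conv_right (H := ModuleCat.of k H) (P := pwObj k H n)
      (ofHom_mul'_assoc k E) (ofHom_linearMap_mul' k E)
      (comulLeft_pushHom _ (ModuleCat.hom_ext bb.yang_baxter)
        (ModuleCat.hom_ext bb.braid_comul_left) n)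
      (pushHom_counit_left _ (ModuleCat.hom_ext bb.braid_counit_left) n)
      (f := ModuleCat.ofHom u) (f' := ModuleCat.ofHom ub)
      (g := ModuleCat.ofHom (prodPow u n))
      (g' := ModuleCat.ofHom (prodPow ub n ∘ₗ grev bb.c.toLinearMap n))
      (τ := pushHom bb.c.toLinearMap n) (δ := ModuleCat.ofHom Coalgebra.comul)
      (ModuleCat.hom_ext hu) (ModuleCat.hom_ext ih)
    exact congrArg ModuleCat.Hom.hom
      ((congrArg (· ≫ _) (comulP_succ bb.c.toLinearMap Coalgebra.comul n)).trans h)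

theorem prodPow_grev_conv_prodPow
    (hu : LinearMap.mul' k E ∘ₗ TensorProduct.map ub u ∘ₗ Coalgebra.comul =
      Algebra.linearMap k E ∘ₗ Coalgebra.counit) (n : ℕ) :
    LinearMap.mul' k E ∘ₗ
        TensorProduct.map (prodPow ub n ∘ₗ grev bb.c.toLinearMap n) (prodPow u n) ∘ₗ
        comulP bb.c.toLinearMap Coalgebra.comul n =
      Algebra.linearMap k E ∘ₗ counitP Coalgebra.counit n := by
  induction n with
  | zero => exact hu
  | succ n ih =>
    rw [prodPow_comp_grev_succ, prodPow_succ]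
    have h := conv_left (H := ModuleCat.of k H) (P := pwObj k H n)
      (ofHom_mul'_assoc k E) (ofHom_linearMap_mul' k E)
      (comulRight_pushHom _ (ModuleCat.hom_ext bb.braid_comul_right) n)
      (pushHom_counit_right _ (ModuleCat.hom_ext bb.braid_counit_right) n)
      (f := ModuleCat.ofHom u) (f' := ModuleCat.ofHom ub)
      (g := ModuleCat.ofHom (prodPow u n))
      (g' := ModuleCat.ofHom (prodPow ub n ∘ₗ grev bb.c.toLinearMap n))
      (τ := pushHom bb.c.toLinearMap n)
      (Δ := ModuleCat.ofHom (comulP bb.c.toLinearMap Coalgebra.comul n))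
      (ModuleCat.hom_ext hu) (ModuleCat.hom_ext ih)
    exact congrArg ModuleCat.Hom.hom
      ((congrArg (· ≫ _) (comulP_succ bb.c.toLinearMap Coalgebra.comul n)).trans h)

end Concrete

/-- For a convolution invertible `u : H → E` (with convolution inverse `ū`), each
`μ_{n+1}∘u^{⊗(n+1)} : H^{⊗_c(n+1)} → E` is convolution invertible with convolution
inverse `μ_{n+1}∘ū^{⊗(n+1)}∘γ_{n+1}`. -/
theorem convInv_prodPow {H E : Type u} [Ring H] [Algebra k H] [Coalgebra k H]
    [Ring E] [Algebra k E]
    (bb : BraidedBialgebra k H) (u ub : H →ₗ[k] E)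
    (hu : LinearMap.mul' k E ∘ₗ TensorProduct.map u ub
            ∘ₗ (Coalgebra.comul (R := k) (A := H))
          = Algebra.linearMap k E ∘ₗ (Coalgebra.counit (R := k) (A := H)))
    (hu' : LinearMap.mul' k E ∘ₗ TensorProduct.map ub u
            ∘ₗ (Coalgebra.comul (R := k) (A := H))
          = Algebra.linearMap k E ∘ₗ (Coalgebra.counit (R := k) (A := H))) :
    ∀ n : ℕ,
      (LinearMap.mul' k E
          ∘ₗ TensorProduct.map (prodPow u n) (prodPow ub n ∘ₗ grev bb.c.toLinearMap n)
          ∘ₗ comulP bb.c.toLinearMap (Coalgebra.comul (R := k) (A := H)) n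
        = Algebra.linearMap k E ∘ₗ counitP (Coalgebra.counit (R := k) (A := H)) n) ∧
      (LinearMap.mul' k E
          ∘ₗ TensorProduct.map (prodPow ub n ∘ₗ grev bb.c.toLinearMap n) (prodPow u n)
          ∘ₗ comulP bb.c.toLinearMap (Coalgebra.comul (R := k) (A := H)) n
        = Algebra.linearMap k E ∘ₗ counitP (Coalgebra.counit (R := k) (A := H)) n) := by
  exact fun n ↦ ⟨prodPow_conv_prodPow_grev bb hu n, prodPow_grev_conv_prodPow bb hu' n⟩
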